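/- In the exact-data case, the increments of the LMK iteration are square summable with the quantitative bound Σ_{k=0}^∞ ‖x_{k+1} − x_k‖² ≤ ‖x₀ − x*‖² < ∞. -/

import Mathlib

open Metric Filter

open ContinuousLinearMap in
/-- The residual of the linearized equation after one regularized step dominates a fixed
fraction of the residual before the step. -/
lemma mul_norm_le_norm_linearized_residual
    {X Y : Type*} [NormedAddCommGroup X] [InnerProductSpace ℝ X] [CompleteSpace X]
    [NormedAddCommGroup Y] [InnerProductSpace ℝ Y] [CompleteSpace Y]
    (A : X →L[ℝ] Y) (h : X) (r : Y) {C q α : ℝ} (hA : ‖A‖ ≤ C) (hq0 : 0 < q) (hq1 : q < 1)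
    (hα0 : 0 < α) (hα : C ^ 2 * q / (1 - q) < α)
    (hh : adjoint A (A h) + α • h = adjoint A r) :
    q * ‖r‖ ≤ ‖A h - r‖ := by
  have hC : 0 ≤ C := (norm_nonneg A).trans hA
  have hαh : α • h = -adjoint A (A h - r) := by
    rw [map_sub, ← hh]; abel
  have h1 : α * ‖h‖ ≤ C * ‖A h - r‖ := by
    calc α * ‖h‖ = ‖α • h‖ := by rw [norm_smul, Real.norm_of_nonneg hα0.le]
      _ = ‖adjoint A (A h - r)‖ := by rw [hαh, norm_neg]
      _ ≤ C * ‖A h - r‖ := le_of_opNorm_le _ (by simpa using hA) _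
  have h2 : ‖A h‖ ≤ C * ‖h‖ := A.le_of_opNorm_le hA h
  have h3 : ‖r‖ ≤ ‖A h‖ + ‖A h - r‖ := by
    simpa using norm_sub_le (A h) (A h - r)
  have h4 : C ^ 2 * q < α * (1 - q) := (div_lt_iff₀ (by linarith)).1 hα
  have h5 : α * ‖r‖ ≤ (C ^ 2 + α) * ‖A h - r‖ := by
    nlinarith [mul_le_mul_of_nonneg_left h1 hC, mul_le_mul_of_nonneg_left h2 hα0.le,
      mul_le_mul_of_nonneg_left h3 hα0.le]
  have h6 : α * (q * ‖r‖) ≤ α * ‖A h - r‖ := by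
    nlinarith [mul_le_mul_of_nonneg_left h5 hq0.le,
      mul_le_mul_of_nonneg_right h4.le (norm_nonneg (A h - r))]
  exact le_of_mul_le_mul_left h6 hα0

open ContinuousLinearMap in
/-- One regularized step `h` decreases the squared error `‖e‖ ^ 2` by at least `‖h‖ ^ 2`, provided
the linearization error `r + A e` is small compared with the linearized residual. -/
lemma norm_add_sq_add_norm_sq_le
    {X Y : Type*} [NormedAddCommGroup X] [InnerProductSpace ℝ X] [CompleteSpace X]
    [NormedAddCommGroup Y] [InnerProductSpace ℝ Y] [CompleteSpace Y]
    (A : X →L[ℝ] Y) (e h : X) (r : Y) {α : ℝ} (hα0 : 0 < α)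
    (hh : adjoint A (A h) + α • h = adjoint A r) (hle : ‖r + A e‖ ≤ ‖A h - r‖) :
    ‖e + h‖ ^ 2 + ‖h‖ ^ 2 ≤ ‖e‖ ^ 2 := by
  have hαh : ∀ z, α * inner ℝ h z = -inner ℝ (A h - r) (A z) := fun z ↦ by
    have : α • h = -adjoint A (A h - r) := by
      rw [map_sub, ← hh]; abel
    rw [← real_inner_smul_left, this, inner_neg_left, adjoint_inner_left]
  have hhe : inner ℝ h (e + h) ≤ 0 := by
    have h1 : α * inner ℝ h (e + h)
        = -inner ℝ (A h - r) (r + A e) - ‖A h - r‖ ^ 2 := by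
      rw [hαh, ← real_inner_self_eq_norm_sq, ← sub_eq_zero]
      simp only [map_add, inner_add_right, inner_sub_right]
      ring
    have h2 := (abs_le.1 (abs_real_inner_le_norm (A h - r) (r + A e))).1
    have h3 := mul_le_mul_of_nonneg_left hle (norm_nonneg (A h - r))
    exact nonpos_of_mul_nonpos_right (by nlinarith) hα0
  rw [inner_add_right, real_inner_self_eq_norm_sq, real_inner_comm] at hhe
  rw [norm_add_sq_real]
  linarith

/-- exact data: the increments of the LMK iteration are square summable with
`∑ₖ ‖x_{k+1} - x_k‖² ≤ ‖x₀ - x*‖² < ∞`. -/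
theorem stmt_11
    {X Y : Type*} [NormedAddCommGroup X] [InnerProductSpace ℝ X] [CompleteSpace X]
    [NormedAddCommGroup Y] [InnerProductSpace ℝ Y] [CompleteSpace Y]
    (N : ℕ) (hN : 1 ≤ N)
    (F : ℕ → X → Y) (F' : ℕ → X → (X →L[ℝ] Y))
    (hFcont : ∀ i < N, Continuous (F i)) (hF'cont : ∀ i < N, Continuous (F' i))
    (x₀ xstar : X) (ρ C η : ℝ) (hρ : 0 < ρ) (hC : 0 < C) (hη0 : 0 ≤ η) (hη1 : η < 1)
    (hA1 : ∀ i < N, ∀ x ∈ closedBall x₀ ρ, ‖F' i x‖ ≤ C)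
    (hA2 : ∀ i < N, ∀ x ∈ closedBall x₀ ρ, ∀ x' ∈ closedBall x₀ ρ,
        ‖F i x' - F i x - F' i x (x' - x)‖ ≤ η * ‖F i x' - F i x‖)
    (y : ℕ → Y) (hA3 : xstar ∈ closedBall x₀ (ρ / 2)) (hsol : ∀ i < N, F i xstar = y i)
    (q α τ : ℝ) (hq0 : 0 < q) (hq1 : q < 1)
    (hα : C ^ 2 * q / (1 - q) < α)
    (hτ : (1 + η) / (1 - η) < τ) (hqτ : η + (1 + η) / τ < q)
    (x h : ℕ → X)
    (hx0 : x 0 = x₀)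
    (hh : ∀ k, ContinuousLinearMap.adjoint (F' (k % N) (x k)) (F' (k % N) (x k) (h k))
        + α • h k
        = ContinuousLinearMap.adjoint (F' (k % N) (x k)) (y (k % N) - F (k % N) (x k)))
    (hrec : ∀ k, x (k + 1) = x k + h k)
    :
    Summable (fun k : ℕ => ‖x (k + 1) - x k‖ ^ 2) ∧
      ∑' k : ℕ, ‖x (k + 1) - x k‖ ^ 2 ≤ ‖x₀ - xstar‖ ^ 2 := by
  have hητ : η < q := by
    have : 0 < (1 + η) / τ :=
      div_pos (by linarith) ((div_pos (by linarith) (by linarith)).trans hτ)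
    linarith
  have hα0 : 0 < α :=
    lt_of_le_of_lt (div_nonneg (by positivity) (by linarith)) hα
  have hstep : ∀ k, x k ∈ closedBall x₀ ρ →
      ‖x (k + 1) - xstar‖ ^ 2 + ‖x (k + 1) - x k‖ ^ 2 ≤ ‖x k - xstar‖ ^ 2 := by
    intro k hk
    have hi : k % N < N := Nat.mod_lt _ hN
    have hlin := hA2 _ hi _ hk _ (closedBall_subset_closedBall (by linarith) hA3)
    rw [hsol _ hi] at hlin
    have hres := mul_norm_le_norm_linearized_residual _ _ _ (hA1 _ hi _ hk) hq0 hq1 hα0 hα (hh k)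
    have hle : ‖y (k % N) - F (k % N) (x k) + F' (k % N) (x k) (x k - xstar)‖
        ≤ ‖F' (k % N) (x k) (h k) - (y (k % N) - F (k % N) (x k))‖ := by
      rw [← neg_sub xstar, map_neg, ← sub_eq_add_neg]
      exact hlin.trans ((mul_le_mul_of_nonneg_right hητ.le (norm_nonneg _)).trans hres)
    have := norm_add_sq_add_norm_sq_le _ _ _ _ hα0 (hh k) hle
    rwa [sub_add_eq_add_sub, ← hrec, show h k = x (k + 1) - x k by simp [hrec]] at this
  rw [mem_closedBall, dist_comm, dist_eq_norm] at hA3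
  have hnear : ∀ k, ‖x k - xstar‖ ≤ ρ / 2 → x k ∈ closedBall x₀ ρ := by
    intro k hk
    rw [mem_closedBall, dist_eq_norm]
    have := norm_sub_le (x k - xstar) (x₀ - xstar)
    rw [sub_sub_sub_cancel_right] at this
    linarith
  have hball : ∀ k, ‖x k - xstar‖ ≤ ρ / 2 := by
    intro k
    induction k with
    | zero => rwa [hx0]
    | succ k ih =>
      refine le_trans ((sq_le_sq₀ (norm_nonneg _) (norm_nonneg _)).1 ?_) ih
      nlinarith [hstep k (hnear k ih), sq_nonneg ‖x (k + 1) - x k‖]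
  have hsum : ∀ n, ∑ k ∈ Finset.range n, ‖x (k + 1) - x k‖ ^ 2
      ≤ ‖x₀ - xstar‖ ^ 2 := by
    intro n
    have : ∑ k ∈ Finset.range n, ‖x (k + 1) - x k‖ ^ 2
        ≤ ∑ k ∈ Finset.range n, (‖x k - xstar‖ ^ 2 - ‖x (k + 1) - xstar‖ ^ 2) :=
      Finset.sum_le_sum fun k _ ↦ by linarith [hstep k (hnear k (hball k))]
    rw [Finset.sum_range_sub', hx0] at this
    linarith [sq_nonneg ‖x n - xstar‖]
  exact ⟨summable_of_sum_range_le (fun _ ↦ sq_nonneg _) hsum,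
    Real.tsum_le_of_sum_range_le (fun _ ↦ sq_nonneg _) hsum⟩
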